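/- arXiv:1111.4937 — 2 statements merged into one kernel-verified Lean document; each statement's English description precedes it below -/
import Mathlib

section
/- Let M be a mosaic floorplan in standard form with n blocks (n ≥ 1). Suppose R_n, R_{n-1}, …, R_1 are sets of blocks and r_n, …, r_2 are blocks such that R_n = M and, for each i with 2 ≤ i ≤ n, r_i is a deletable rectangle of R_i and R_{i-1} = R_i ∖ {r_i}. Then for every i with 1 ≤ i ≤ n, the staircase R_i has exactly one deletable rectangle. -/
open Set

/-- A block is a closed axis-parallel rectangle `[x1,x2] × [y1,y2]` with `x1 < x2`, `y1 < y2`. -/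
def IsBlock (b : Set (ℝ × ℝ)) : Prop :=
  ∃ x1 x2 y1 y2 : ℝ, x1 < x2 ∧ y1 < y2 ∧ b = Icc x1 x2 ×ˢ Icc y1 y2

/-- `R` is a staircase with `m` steps, step x-coordinates `a 0 < a 1 < ⋯ < a m`
(with `a 0 = 0`) and step heights `h 1 > h 2 > ⋯ > h m > 0`. -/
def IsStaircaseWith (R : Finset (Set (ℝ × ℝ))) (m : ℕ) (a h : ℕ → ℝ) : Prop :=
  R.Nonempty ∧
  (∀ b ∈ R, IsBlock b) ∧
  (∀ b ∈ R, ∀ b' ∈ R, b ≠ b' → interior b ∩ interior b' = ∅) ∧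
  (∀ (p : ℝ × ℝ) (b1 b2 b3 b4 : Set (ℝ × ℝ)),
      b1 ∈ R → b2 ∈ R → b3 ∈ R → b4 ∈ R →
      p ∈ b1 → p ∈ b2 → p ∈ b3 → p ∈ b4 →
      b1 = b2 ∨ b1 = b3 ∨ b1 = b4 ∨ b2 = b3 ∨ b2 = b4 ∨ b3 = b4) ∧
  1 ≤ m ∧
  a 0 = 0 ∧
  (∀ j, j < m → a j < a (j + 1)) ∧
  (∀ j, 1 ≤ j → j < m → h (j + 1) < h j) ∧
  0 < h m ∧
  ⋃₀ (R : Set (Set (ℝ × ℝ))) =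
    ⋃ j ∈ Finset.Icc 1 m, Icc (a (j - 1)) (a j) ×ˢ Icc (0 : ℝ) (h j)

/-- `R` is a staircase. -/
def IsStaircase (R : Finset (Set (ℝ × ℝ))) : Prop :=
  ∃ m a h, IsStaircaseWith R m a h

/-- `r` is a deletable rectangle of `R`: a block of `R` whose top edge and right
edge are both contained in the topological boundary of `⋃ R`. -/
def IsDeletable (R : Finset (Set (ℝ × ℝ))) (r : Set (ℝ × ℝ)) : Prop :=
  r ∈ R ∧ ∃ x1 x2 y1 y2 : ℝ, x1 < x2 ∧ y1 < y2 ∧ r = Icc x1 x2 ×ˢ Icc y1 y2 ∧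
    (Icc x1 x2 ×ˢ ({y2} : Set ℝ)) ⊆ frontier (⋃₀ (R : Set (Set (ℝ × ℝ)))) ∧
    (({x2} : Set ℝ) ×ˢ Icc y1 y2) ⊆ frontier (⋃₀ (R : Set (Set (ℝ × ℝ))))

/-- A mosaic floorplan is a staircase with exactly one step. -/
def IsMosaicFloorplan (M : Finset (Set (ℝ × ℝ))) : Prop :=
  ∃ a h, IsStaircaseWith M 1 a h

noncomputable instance : DecidableEq (Set (ℝ × ℝ)) := Classical.decEq _

/-- A horizontal line segment of positive length. -/
def IsHSeg (s : Set (ℝ × ℝ)) : Prop :=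
  ∃ x1 x2 y : ℝ, x1 < x2 ∧ s = Icc x1 x2 ×ˢ ({y} : Set ℝ)

/-- A vertical line segment of positive length. -/
def IsVSeg (s : Set (ℝ × ℝ)) : Prop :=
  ∃ x y1 y2 : ℝ, y1 < y2 ∧ s = ({x} : Set ℝ) ×ˢ Icc y1 y2

/-- `Γ`, the union of the boundaries of the blocks of `M`. -/
def SegUnion (M : Finset (Set (ℝ × ℝ))) : Set (ℝ × ℝ) :=
  ⋃ b ∈ M, frontier b

/-- A maximal horizontal segment of `M`: a horizontal segment contained in `Γ`
that is maximal with respect to inclusion among such segments. -/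
def MaxHSeg (M : Finset (Set (ℝ × ℝ))) (s : Set (ℝ × ℝ)) : Prop :=
  IsHSeg s ∧ s ⊆ SegUnion M ∧
    ∀ s', IsHSeg s' → s' ⊆ SegUnion M → s ⊆ s' → s' = s

/-- A maximal vertical segment of `M`. -/
def MaxVSeg (M : Finset (Set (ℝ × ℝ))) (s : Set (ℝ × ℝ)) : Prop :=
  IsVSeg s ∧ s ⊆ SegUnion M ∧
    ∀ s', IsVSeg s' → s' ⊆ SegUnion M → s ⊆ s' → s' = s

/-- `M` is in standard form:
* for every maximal horizontal segment `h` (at height `y`), every maximal vertical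
  segment intersecting `h` that lies in the closed half-plane above the line of `h`
  has x-coordinate strictly greater than that of every maximal vertical segment
  intersecting `h` lying in the closed half-plane below that line;
* for every maximal vertical segment `v` (at abscissa `x`), every maximal horizontal
  segment intersecting `v` lying in the closed half-plane to the right of the line
  of `v` has y-coordinate strictly greater than that of every maximal horizontal
  segment intersecting `v` lying in the closed half-plane to the left of that line. -/
def StandardForm (M : Finset (Set (ℝ × ℝ))) : Prop :=
  (∀ x1 x2 y : ℝ, x1 < x2 → MaxHSeg M (Icc x1 x2 ×ˢ ({y} : Set ℝ)) →
    ∀ xa ya1 ya2 : ℝ, ya1 < ya2 → MaxVSeg M (({xa} : Set ℝ) ×ˢ Icc ya1 ya2) →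
      ((({xa} : Set ℝ) ×ˢ Icc ya1 ya2) ∩ (Icc x1 x2 ×ˢ ({y} : Set ℝ))).Nonempty →
      y ≤ ya1 →
    ∀ xb yb1 yb2 : ℝ, yb1 < yb2 → MaxVSeg M (({xb} : Set ℝ) ×ˢ Icc yb1 yb2) →
      ((({xb} : Set ℝ) ×ˢ Icc yb1 yb2) ∩ (Icc x1 x2 ×ˢ ({y} : Set ℝ))).Nonempty →
      yb2 ≤ y →
    xb < xa) ∧
  (∀ x y1 y2 : ℝ, y1 < y2 → MaxVSeg M (({x} : Set ℝ) ×ˢ Icc y1 y2) →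
    ∀ ya xa1 xa2 : ℝ, xa1 < xa2 → MaxHSeg M (Icc xa1 xa2 ×ˢ ({ya} : Set ℝ)) →
      ((Icc xa1 xa2 ×ˢ ({ya} : Set ℝ)) ∩ (({x} : Set ℝ) ×ˢ Icc y1 y2)).Nonempty →
      x ≤ xa1 →
    ∀ yb xb1 xb2 : ℝ, xb1 < xb2 → MaxHSeg M (Icc xb1 xb2 ×ˢ ({yb} : Set ℝ)) →
      ((Icc xb1 xb2 ×ˢ ({yb} : Set ℝ)) ∩ (({x} : Set ℝ) ×ˢ Icc y1 y2)).Nonempty →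
      xb2 ≤ x →
    yb < ya)

/-- Two blocks are adjacent if their intersection is a line segment of positive
length. -/
def Adjacent (b b' : Set (ℝ × ℝ)) : Prop :=
  ∃ s : Set (ℝ × ℝ), (IsHSeg s ∨ IsVSeg s) ∧ b ∩ b' = s

/-! ### Coordinates of blocks -/

/-- The abscissa of the left edge of a block. -/
noncomputable def leftEdge (b : Set (ℝ × ℝ)) : ℝ := sInf (Prod.fst '' b)

/-- The abscissa of the right edge of a block. -/
noncomputable def rightEdge (b : Set (ℝ × ℝ)) : ℝ := sSup (Prod.fst '' b)

/-- The ordinate of the bottom edge of a block. -/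
noncomputable def botEdge (b : Set (ℝ × ℝ)) : ℝ := sInf (Prod.snd '' b)

/-- The ordinate of the top edge of a block. -/
noncomputable def topEdge (b : Set (ℝ × ℝ)) : ℝ := sSup (Prod.snd '' b)

theorem edges_Icc_prod {x1 x2 y1 y2 : ℝ} (hx : x1 < x2) (hy : y1 < y2) :
    leftEdge (Icc x1 x2 ×ˢ Icc y1 y2) = x1 ∧ rightEdge (Icc x1 x2 ×ˢ Icc y1 y2) = x2 ∧
      botEdge (Icc x1 x2 ×ˢ Icc y1 y2) = y1 ∧ topEdge (Icc x1 x2 ×ˢ Icc y1 y2) = y2 := by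
  have h1 : (Icc x1 x2).Nonempty := nonempty_Icc.2 hx.le
  have h2 : (Icc y1 y2).Nonempty := nonempty_Icc.2 hy.le
  simp only [leftEdge, rightEdge, botEdge, topEdge, fst_image_prod _ h2, snd_image_prod h1,
    csInf_Icc hx.le, csSup_Icc hx.le, csInf_Icc hy.le, csSup_Icc hy.le, and_self]

theorem IsBlock.edges {b : Set (ℝ × ℝ)} (hb : IsBlock b) :
    leftEdge b < rightEdge b ∧ botEdge b < topEdge b ∧
      b = Icc (leftEdge b) (rightEdge b) ×ˢ Icc (botEdge b) (topEdge b) := by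
  obtain ⟨x1, x2, y1, y2, hx, hy, rfl⟩ := hb
  obtain ⟨h1, h2, h3, h4⟩ := edges_Icc_prod hx hy
  rw [h1, h2, h3, h4]
  exact ⟨hx, hy, rfl⟩

theorem IsBlock.mem_iff {b : Set (ℝ × ℝ)} (hb : IsBlock b) {p : ℝ × ℝ} :
    p ∈ b ↔ (leftEdge b ≤ p.1 ∧ p.1 ≤ rightEdge b) ∧ botEdge b ≤ p.2 ∧ p.2 ≤ topEdge b := by
  conv_lhs => rw [hb.edges.2.2]
  simp only [mem_prod, mem_Icc]

theorem IsBlock.interior_eq {b : Set (ℝ × ℝ)} (hb : IsBlock b) :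
    interior b = Ioo (leftEdge b) (rightEdge b) ×ˢ Ioo (botEdge b) (topEdge b) := by
  conv_lhs => rw [hb.edges.2.2]
  rw [interior_prod_eq, interior_Icc, interior_Icc]

theorem IsBlock.isClosed {b : Set (ℝ × ℝ)} (hb : IsBlock b) : IsClosed b := by
  rw [hb.edges.2.2]
  exact isClosed_Icc.prod isClosed_Icc

theorem IsBlock.mem_frontier {b : Set (ℝ × ℝ)} (hb : IsBlock b) {p : ℝ × ℝ} :
    p ∈ frontier b ↔ p ∈ b ∧ ¬ ((leftEdge b < p.1 ∧ p.1 < rightEdge b) ∧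
      botEdge b < p.2 ∧ p.2 < topEdge b) := by
  rw [hb.isClosed.frontier_eq, hb.interior_eq]
  simp only [mem_sdiff, mem_prod, mem_Ioo]

/-- `M` is a family of blocks tiling `[0,W] × [0,H]`, no four of them meeting in a point. -/
structure IsTiling (M : Finset (Set (ℝ × ℝ))) (W H : ℝ) : Prop where
  block : ∀ b ∈ M, IsBlock b
  disjoint : ∀ b ∈ M, ∀ c ∈ M, leftEdge b < rightEdge c → leftEdge c < rightEdge b →
    botEdge b < topEdge c → botEdge c < topEdge b → b = c
  bounds : ∀ b ∈ M, (0 ≤ leftEdge b ∧ rightEdge b ≤ W) ∧ 0 ≤ botEdge b ∧ topEdge b ≤ H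
  cover : ∀ x y, 0 ≤ x → x ≤ W → 0 ≤ y → y ≤ H → ∃ b ∈ M,
    (leftEdge b ≤ x ∧ x ≤ rightEdge b) ∧ botEdge b ≤ y ∧ y ≤ topEdge b
  not_four : ∀ (p : ℝ × ℝ) (b1 b2 b3 b4 : Set (ℝ × ℝ)),
    b1 ∈ M → b2 ∈ M → b3 ∈ M → b4 ∈ M → p ∈ b1 → p ∈ b2 → p ∈ b3 → p ∈ b4 →
    b1 = b2 ∨ b1 = b3 ∨ b1 = b4 ∨ b2 = b3 ∨ b2 = b4 ∨ b3 = b4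

theorem IsMosaicFloorplan.isTiling {M : Finset (Set (ℝ × ℝ))} (hM : IsMosaicFloorplan M) :
    ∃ W H, IsTiling M W H := by
  obtain ⟨a, h, -, hblock, hdisj, hfour, -, ha0, -, -, -, hU⟩ := hM
  have hU : ⋃₀ (M : Set (Set (ℝ × ℝ))) = Icc 0 (a 1) ×ˢ Icc 0 (h 1) := by
    simpa [ha0] using hU
  refine ⟨a 1, h 1, hblock, ?_, ?_, ?_, hfour⟩
  · intro b hb c hc h1 h2 h3 h4
    by_contra hne
    have hdis := hdisj b hb c hc hne
    rw [(hblock b hb).interior_eq, (hblock c hc).interior_eq, prod_inter_prod, Ioo_inter_Ioo,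
      Ioo_inter_Ioo, prod_eq_empty_iff, Ioo_eq_empty_iff, Ioo_eq_empty_iff] at hdis
    obtain ⟨hbx, hby, -⟩ := (hblock b hb).edges
    obtain ⟨hcx, hcy, -⟩ := (hblock c hc).edges
    rcases hdis with hd | hd <;> refine hd (max_lt (lt_min ?_ ?_) (lt_min ?_ ?_)) <;> assumption
  · intro b hb
    have hsub : b ⊆ Icc 0 (a 1) ×ˢ Icc 0 (h 1) := hU ▸ subset_sUnion_of_mem hb
    obtain ⟨hbx, hby, -⟩ := (hblock b hb).edges
    have h1 : (leftEdge b, botEdge b) ∈ b :=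
      (hblock b hb).mem_iff.2 ⟨⟨le_rfl, hbx.le⟩, le_rfl, hby.le⟩
    have h2 : (rightEdge b, topEdge b) ∈ b :=
      (hblock b hb).mem_iff.2 ⟨⟨hbx.le, le_rfl⟩, hby.le, le_rfl⟩
    have h1 := hsub h1
    have h2 := hsub h2
    simp only [mem_prod, mem_Icc] at h1 h2
    exact ⟨⟨h1.1.1, h2.1.2⟩, h1.2.1, h2.2.2⟩
  · intro x y hx hx' hy hy'
    have hp : (x, y) ∈ ⋃₀ (M : Set (Set (ℝ × ℝ))) := hU ▸ ⟨⟨hx, hx'⟩, hy, hy'⟩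
    obtain ⟨b, hb, hpb⟩ := hp
    exact ⟨b, hb, (hblock b hb).mem_iff.1 hpb⟩

/-! ### Blocks filling a quadrant at a point -/

theorem exists_right_of_finset {α : Type*} (M : Finset α) (f : α → ℝ) {x w : ℝ} (hx : x < w) :
    ∃ t, x < t ∧ t ≤ w ∧ ∀ b ∈ M, f b ≤ t → f b ≤ x := by
  have hev : ∀ᶠ t in nhdsWithin x (Ioi x), ∀ b ∈ M, f b ≤ t → f b ≤ x := by
    rw [Filter.eventually_all_finset]
    intro b _
    by_cases hb : f b ≤ x
    · exact Filter.Eventually.of_forall fun _ _ => hb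
    · filter_upwards [Ioo_mem_nhdsGT (not_le.1 hb)] with t ht hbt
      exact absurd hbt (not_le.2 ht.2)
  obtain ⟨t, ht, htx⟩ := (hev.and (Ioo_mem_nhdsGT hx)).exists
  exact ⟨t, htx.1, htx.2.le, ht⟩

theorem exists_left_of_finset {α : Type*} (M : Finset α) (f : α → ℝ) {x w : ℝ} (hx : w < x) :
    ∃ t, t < x ∧ w ≤ t ∧ ∀ b ∈ M, t ≤ f b → x ≤ f b := by
  obtain ⟨t, h1, h2, h3⟩ := exists_right_of_finset M (fun b => - f b) (neg_lt_neg hx)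
  refine ⟨-t, by linarith, by linarith, fun b hb hbt => ?_⟩
  have := h3 b hb (by linarith)
  linarith

namespace IsTiling

variable {M : Finset (Set (ℝ × ℝ))} {W H : ℝ}

theorem exists_upper_right (hM : IsTiling M W H) {x y : ℝ} (hx : 0 ≤ x) (hx' : x < W)
    (hy : 0 ≤ y) (hy' : y < H) : ∃ b ∈ M,
    (leftEdge b ≤ x ∧ x < rightEdge b) ∧ botEdge b ≤ y ∧ y < topEdge b := by
  obtain ⟨s, hs1, hs2, hs⟩ := exists_right_of_finset M leftEdge hx'
  obtain ⟨t, ht1, ht2, ht⟩ := exists_right_of_finset M botEdge hy'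
  obtain ⟨b, hb, h1, h2⟩ := hM.cover s t (hx.trans hs1.le) hs2 (hy.trans ht1.le) ht2
  exact ⟨b, hb, ⟨hs b hb h1.1, hs1.trans_le h1.2⟩, ht b hb h2.1, ht1.trans_le h2.2⟩

theorem exists_upper_left (hM : IsTiling M W H) {x y : ℝ} (hx : 0 < x) (hx' : x ≤ W)
    (hy : 0 ≤ y) (hy' : y < H) : ∃ b ∈ M,
    (leftEdge b < x ∧ x ≤ rightEdge b) ∧ botEdge b ≤ y ∧ y < topEdge b := by
  obtain ⟨s, hs1, hs2, hs⟩ := exists_left_of_finset M rightEdge hx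
  obtain ⟨t, ht1, ht2, ht⟩ := exists_right_of_finset M botEdge hy'
  obtain ⟨b, hb, h1, h2⟩ := hM.cover s t hs2 (hs1.le.trans hx') (hy.trans ht1.le) ht2
  exact ⟨b, hb, ⟨h1.1.trans_lt hs1, hs b hb h1.2⟩, ht b hb h2.1, ht1.trans_le h2.2⟩

theorem exists_lower_right (hM : IsTiling M W H) {x y : ℝ} (hx : 0 ≤ x) (hx' : x < W)
    (hy : 0 < y) (hy' : y ≤ H) : ∃ b ∈ M,
    (leftEdge b ≤ x ∧ x < rightEdge b) ∧ botEdge b < y ∧ y ≤ topEdge b := by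
  obtain ⟨s, hs1, hs2, hs⟩ := exists_right_of_finset M leftEdge hx'
  obtain ⟨t, ht1, ht2, ht⟩ := exists_left_of_finset M topEdge hy
  obtain ⟨b, hb, h1, h2⟩ := hM.cover s t (hx.trans hs1.le) hs2 ht2 (ht1.le.trans hy')
  exact ⟨b, hb, ⟨hs b hb h1.1, hs1.trans_le h1.2⟩, h2.1.trans_lt ht1, ht b hb h2.2⟩

theorem exists_lower_left (hM : IsTiling M W H) {x y : ℝ} (hx : 0 < x) (hx' : x ≤ W)
    (hy : 0 < y) (hy' : y ≤ H) : ∃ b ∈ M,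
    (leftEdge b < x ∧ x ≤ rightEdge b) ∧ botEdge b < y ∧ y ≤ topEdge b := by
  obtain ⟨s, hs1, hs2, hs⟩ := exists_left_of_finset M rightEdge hx
  obtain ⟨t, ht1, ht2, ht⟩ := exists_left_of_finset M topEdge hy
  obtain ⟨b, hb, h1, h2⟩ := hM.cover s t hs2 (hs1.le.trans hx') ht2 (ht1.le.trans hy')
  exact ⟨b, hb, ⟨h1.1.trans_lt hs1, hs b hb h1.2⟩, h2.1.trans_lt ht1, ht b hb h2.2⟩

end IsTiling

/-! ### Maximal segments -/

theorem exists_maximal_Icc {K : Set ℝ} (hK : IsCompact K) {p q : ℝ} (hpq : p < q)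
    (hsub : Icc p q ⊆ K) : ∃ s t, s ≤ p ∧ q ≤ t ∧ Icc s t ⊆ K ∧
      ∀ s' t', s' < t' → Icc s' t' ⊆ K → Icc s t ⊆ Icc s' t' → Icc s' t' = Icc s t := by
  have hp : p ∈ K := hsub (left_mem_Icc.2 hpq.le)
  have hclosed : IsClosed (connectedComponentIn K p) := closure_subset_iff_isClosed.1 <|
    isPreconnected_connectedComponentIn.closure.subset_connectedComponentIn
      (subset_closure (mem_connectedComponentIn hp))
      (hK.isClosed.closure_subset_iff.2 (connectedComponentIn_subset K p))
  have hcomp : IsCompact (connectedComponentIn K p) :=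
    hK.of_isClosed_subset hclosed (connectedComponentIn_subset K p)
  have hconn : IsConnected (connectedComponentIn K p) := isConnected_connectedComponentIn_iff.2 hp
  have heq := eq_Icc_of_connected_compact hconn hcomp
  have hpq' : Icc p q ⊆ connectedComponentIn K p :=
    isPreconnected_Icc.subset_connectedComponentIn (left_mem_Icc.2 hpq.le) hsub
  have hKsub := connectedComponentIn_subset K p
  generalize sInf (connectedComponentIn K p) = s at heq
  generalize sSup (connectedComponentIn K p) = t at heq
  rw [heq] at hpq' hKsub
  obtain ⟨hs, ht⟩ := (Icc_subset_Icc_iff hpq.le).1 hpq'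
  refine ⟨s, t, hs, ht, hKsub, fun s' t' _ hs't' hst => subset_antisymm ?_ hst⟩
  rw [← heq]
  exact isPreconnected_Icc.subset_connectedComponentIn
    (hst ⟨hs, hpq.le.trans ht⟩) hs't'

theorem IsHSeg.exists_eq_of_superset {x1 x2 y : ℝ} (hx : x1 < x2) {s : Set (ℝ × ℝ)}
    (hs : IsHSeg s) (hsub : Icc x1 x2 ×ˢ ({y} : Set ℝ) ⊆ s) :
    ∃ u v, u < v ∧ s = Icc u v ×ˢ {y} ∧ Icc x1 x2 ⊆ Icc u v := by
  obtain ⟨u, v, w, huv, rfl⟩ := hs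
  have hyw : y = w := (hsub (show (x1, y) ∈ _ from ⟨left_mem_Icc.2 hx.le, rfl⟩)).2
  subst hyw
  exact ⟨u, v, huv, rfl, fun z hz => (hsub (show (z, y) ∈ _ from ⟨hz, rfl⟩)).1⟩

theorem IsVSeg.exists_eq_of_superset {x y1 y2 : ℝ} (hy : y1 < y2) {s : Set (ℝ × ℝ)}
    (hs : IsVSeg s) (hsub : ({x} : Set ℝ) ×ˢ Icc y1 y2 ⊆ s) :
    ∃ u v, u < v ∧ s = ({x} : Set ℝ) ×ˢ Icc u v ∧ Icc y1 y2 ⊆ Icc u v := by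
  obtain ⟨w, u, v, huv, rfl⟩ := hs
  have hxw : x = w := (hsub (show (x, y1) ∈ _ from ⟨rfl, left_mem_Icc.2 hy.le⟩)).1
  subst hxw
  exact ⟨u, v, huv, rfl, fun z hz => (hsub (show (x, z) ∈ _ from ⟨rfl, hz⟩)).2⟩

namespace IsTiling

variable {M : Finset (Set (ℝ × ℝ))} {W H : ℝ}

theorem isCompact_segUnion (hM : IsTiling M W H) : IsCompact (SegUnion M) := by
  refine M.isCompact_biUnion fun b hb => ?_
  have hc : IsCompact b := by
    rw [(hM.block b hb).edges.2.2]
    exact isCompact_Icc.prod isCompact_Icc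
  exact hc.of_isClosed_subset isClosed_frontier hc.isClosed.frontier_subset

theorem mem_segUnion_of_mem_frontier {b : Set (ℝ × ℝ)} (hb : b ∈ M) {p : ℝ × ℝ}
    (hp : p ∈ frontier b) : p ∈ SegUnion M :=
  mem_biUnion (Finset.mem_coe.2 hb) hp

theorem notMem_segUnion (hM : IsTiling M W H) {b : Set (ℝ × ℝ)} (hb : b ∈ M) {p : ℝ × ℝ}
    (h1 : leftEdge b < p.1) (h2 : p.1 < rightEdge b) (h3 : botEdge b < p.2)
    (h4 : p.2 < topEdge b) : p ∉ SegUnion M := by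
  intro hp
  obtain ⟨c, hc, hpc⟩ := mem_iUnion₂.1 hp
  have hpc := (hM.block c hc).mem_frontier.1 hpc
  have hmem := (hM.block c hc).mem_iff.1 hpc.1
  have heq : b = c := hM.disjoint b hb c hc (by linarith) (by linarith) (by linarith) (by linarith)
  subst heq
  exact hpc.2 ⟨⟨h1, h2⟩, h3, h4⟩

theorem exists_maxHSeg (hM : IsTiling M W H) {x1 x2 y : ℝ} (hx : x1 < x2)
    (hsub : ∀ x ∈ Icc x1 x2, (x, y) ∈ SegUnion M) :
    ∃ s t, s ≤ x1 ∧ x2 ≤ t ∧ (∀ x ∈ Icc s t, (x, y) ∈ SegUnion M) ∧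
      MaxHSeg M (Icc s t ×ˢ {y}) := by
  have hK : IsCompact ((fun x : ℝ => (x, y)) ⁻¹' SegUnion M) :=
    (Topology.IsClosedEmbedding.of_continuous_injective_isClosedMap (by fun_prop)
      (fun a b h => (Prod.ext_iff.1 h).1) (isClosedMap_prodMk_right y)).isCompact_preimage
      hM.isCompact_segUnion
  obtain ⟨s, t, hs, ht, hst, hmax⟩ := exists_maximal_Icc hK hx hsub
  have hlt : s < t := by linarith
  refine ⟨s, t, hs, ht, hst, ⟨s, t, y, hlt, rfl⟩, ?_, ?_⟩
  · rintro ⟨x, z⟩ ⟨hxz, rfl⟩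
    exact hst hxz
  · intro s' hs' hs'sub hle
    obtain ⟨u, v, huv, rfl, hss⟩ := hs'.exists_eq_of_superset hlt hle
    rw [hmax u v huv (fun z hz => hs'sub ⟨hz, rfl⟩) hss]

theorem exists_maxVSeg (hM : IsTiling M W H) {x y1 y2 : ℝ} (hy : y1 < y2)
    (hsub : ∀ y ∈ Icc y1 y2, (x, y) ∈ SegUnion M) :
    ∃ s t, s ≤ y1 ∧ y2 ≤ t ∧ (∀ y ∈ Icc s t, (x, y) ∈ SegUnion M) ∧
      MaxVSeg M (({x} : Set ℝ) ×ˢ Icc s t) := by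
  have hK : IsCompact ((fun y : ℝ => (x, y)) ⁻¹' SegUnion M) :=
    (Topology.IsClosedEmbedding.of_continuous_injective_isClosedMap (by fun_prop)
      (fun a b h => (Prod.ext_iff.1 h).2) (isClosedMap_prodMk_left x)).isCompact_preimage
      hM.isCompact_segUnion
  obtain ⟨s, t, hs, ht, hst, hmax⟩ := exists_maximal_Icc hK hy hsub
  have hlt : s < t := by linarith
  refine ⟨s, t, hs, ht, hst, ⟨x, s, t, hlt, rfl⟩, ?_, ?_⟩
  · rintro ⟨z, y⟩ ⟨rfl, hyz⟩
    exact hst hyz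
  · intro s' hs' hs'sub hle
    obtain ⟨u, v, huv, rfl, hss⟩ := hs'.exists_eq_of_superset hlt hle
    rw [hmax u v huv (fun z hz => hs'sub ⟨rfl, hz⟩) hss]

theorem bottom_subset_segUnion (hM : IsTiling M W H) {b : Set (ℝ × ℝ)} (hb : b ∈ M) :
    ∀ x ∈ Icc (leftEdge b) (rightEdge b), (x, botEdge b) ∈ SegUnion M := fun _ hx =>
  mem_segUnion_of_mem_frontier hb <| (hM.block b hb).mem_frontier.2
    ⟨(hM.block b hb).mem_iff.2 ⟨hx, le_rfl, (hM.block b hb).edges.2.1.le⟩, fun h => h.2.1.false⟩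

theorem left_subset_segUnion (hM : IsTiling M W H) {b : Set (ℝ × ℝ)} (hb : b ∈ M) :
    ∀ y ∈ Icc (botEdge b) (topEdge b), (leftEdge b, y) ∈ SegUnion M := fun _ hy =>
  mem_segUnion_of_mem_frontier hb <| (hM.block b hb).mem_frontier.2
    ⟨(hM.block b hb).mem_iff.2 ⟨⟨le_rfl, (hM.block b hb).edges.1.le⟩, hy⟩, fun h => h.1.1.false⟩

/-- In standard form, no block `d` with right edge on the left edge of `r` has its bottom edge
strictly between the bottom and the top of `r`, if the segment through the left edge of `r`
continues below `r` along the right edge of a block `f`. -/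
theorem false_of_left_neighbours (hM : IsTiling M W H) (hstd : StandardForm M)
    {r f d : Set (ℝ × ℝ)} (hr : r ∈ M) (hf : f ∈ M) (hd : d ∈ M)
    (hfr : rightEdge f = leftEdge r) (hdr : rightEdge d = leftEdge r)
    (hf1 : botEdge f < botEdge r) (hf2 : botEdge r < topEdge f)
    (hd1 : botEdge r < botEdge d) (hd2 : botEdge d < topEdge r) : False := by
  obtain ⟨hrx, hry, -⟩ := (hM.block r hr).edges
  obtain ⟨hfx, -, -⟩ := (hM.block f hf).edges
  obtain ⟨hdx, -, -⟩ := (hM.block d hd).edges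
  obtain ⟨v1, v2, hv1, hv2, -, hv⟩ := hM.exists_maxVSeg hry (hM.left_subset_segUnion hr)
  obtain ⟨a1, a2, ha1, ha2, ha, hA⟩ := hM.exists_maxHSeg hrx (hM.bottom_subset_segUnion hr)
  obtain ⟨c1, c2, hc1, hc2, hc, hC⟩ := hM.exists_maxHSeg hdx (hM.bottom_subset_segUnion hd)
  have ha1' : leftEdge r ≤ a1 := by
    by_contra! hlt
    obtain ⟨z, hz1, hz2⟩ := exists_between (max_lt hlt (hfr ▸ hfx))
    obtain ⟨hz3, hz4⟩ := max_lt_iff.1 hz1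
    exact hM.notMem_segUnion hf hz4 (by rwa [hfr]) hf1 hf2 (ha z ⟨hz3.le, by linarith⟩)
  have hc2' : c2 ≤ leftEdge r := by
    by_contra! hlt
    obtain ⟨z, hz1, hz2⟩ := exists_between (lt_min hlt hrx)
    obtain ⟨hz3, hz4⟩ := lt_min_iff.1 hz2
    exact hM.notMem_segUnion hr hz1 hz4 hd1 hd2 (hc z ⟨by linarith, hz3.le⟩)
  have := hstd.2 (leftEdge r) v1 v2 (by linarith) hv (botEdge r) a1 a2 (by linarith) hA
    ⟨(leftEdge r, botEdge r), ⟨⟨ha1, by linarith⟩, rfl⟩, rfl, hv1, by linarith⟩ ha1'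
    (botEdge d) c1 c2 (by linarith) hC
    ⟨(leftEdge r, botEdge d), ⟨⟨by linarith, by linarith⟩, rfl⟩, rfl, by linarith, by linarith⟩ hc2'
  linarith

/-- In standard form, no block `e` with top edge on the bottom edge of `r` has its left edge
strictly between the left and the right edge of `r`, if the segment through the bottom edge of `r`
continues to the left of `r` along the top edge of a block `k`. -/
theorem false_of_lower_neighbours (hM : IsTiling M W H) (hstd : StandardForm M)
    {r k e : Set (ℝ × ℝ)} (hr : r ∈ M) (hk : k ∈ M) (he : e ∈ M)
    (hkr : topEdge k = botEdge r) (her : topEdge e = botEdge r)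
    (hk1 : leftEdge k < leftEdge r) (hk2 : leftEdge r < rightEdge k)
    (he1 : leftEdge r < leftEdge e) (he2 : leftEdge e < rightEdge r) : False := by
  obtain ⟨hrx, hry, -⟩ := (hM.block r hr).edges
  obtain ⟨-, hky, -⟩ := (hM.block k hk).edges
  obtain ⟨-, hey, -⟩ := (hM.block e he).edges
  obtain ⟨v1, v2, hv1, hv2, -, hv⟩ := hM.exists_maxHSeg hrx (hM.bottom_subset_segUnion hr)
  obtain ⟨a1, a2, ha1, ha2, ha, hA⟩ := hM.exists_maxVSeg hry (hM.left_subset_segUnion hr)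
  obtain ⟨c1, c2, hc1, hc2, hc, hC⟩ := hM.exists_maxVSeg hey (hM.left_subset_segUnion he)
  have ha1' : botEdge r ≤ a1 := by
    by_contra! hlt
    obtain ⟨z, hz1, hz2⟩ := exists_between (max_lt hlt (hkr ▸ hky))
    obtain ⟨hz3, hz4⟩ := max_lt_iff.1 hz1
    exact hM.notMem_segUnion hk hk1 hk2 hz4 (by rwa [hkr]) (ha z ⟨hz3.le, by linarith⟩)
  have hc2' : c2 ≤ botEdge r := by
    by_contra! hlt
    obtain ⟨z, hz1, hz2⟩ := exists_between (lt_min hlt hry)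
    obtain ⟨hz3, hz4⟩ := lt_min_iff.1 hz2
    exact hM.notMem_segUnion hr he1 he2 hz1 hz4 (hc z ⟨by linarith, hz3.le⟩)
  have := hstd.1 v1 v2 (botEdge r) (by linarith) hv (leftEdge r) a1 a2 (by linarith) hA
    ⟨(leftEdge r, botEdge r), ⟨rfl, ha1, by linarith⟩, ⟨hv1, by linarith⟩, rfl⟩ ha1'
    (leftEdge e) c1 c2 (by linarith) hC
    ⟨(leftEdge e, botEdge r), ⟨rfl, by linarith, by linarith⟩, ⟨by linarith, by linarith⟩, rfl⟩ hc2'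
  linarith

end IsTiling

/-! ### Deletable rectangles as maximal blocks -/

/-- Some interior point of `b` is strictly dominated, in both coordinates, by a point of `c`. -/
def Precedes (b c : Set (ℝ × ℝ)) : Prop :=
  leftEdge b < rightEdge c ∧ botEdge b < topEdge c

/-- `r` is a block of `R` that precedes no other block of `R`. -/
def IsMaximalBlock (R : Finset (Set (ℝ × ℝ))) (r : Set (ℝ × ℝ)) : Prop :=
  r ∈ R ∧ ∀ b ∈ R, Precedes r b → b = r

/-- `R` is a subfamily of `M` closed under passing to preceding blocks. -/
def IsLowerFamily (M R : Finset (Set (ℝ × ℝ))) : Prop :=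
  R ⊆ M ∧ ∀ b ∈ R, ∀ c ∈ M, Precedes c b → c ∈ R

theorem IsLowerFamily.erase {M R : Finset (Set (ℝ × ℝ))} {r : Set (ℝ × ℝ)}
    (hR : IsLowerFamily M R) (hr : IsMaximalBlock R r) : IsLowerFamily M (R.erase r) := by
  refine ⟨(Finset.erase_subset r R).trans hR.1, fun b hb c hc hcb => ?_⟩
  rw [Finset.mem_erase] at hb ⊢
  refine ⟨?_, hR.2 b hb.2 c hc hcb⟩
  rintro rfl
  exact hb.1 (hr.2 b hb.2 hcb)

/-- A union of blocks contains, near each of its interior points, points of a block extending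
strictly further to the right and to the top. -/
theorem exists_block_of_mem_interior {R : Finset (Set (ℝ × ℝ))} (hR : ∀ b ∈ R, IsBlock b)
    {p : ℝ × ℝ} (hp : p ∈ interior (⋃₀ (R : Set (Set (ℝ × ℝ))))) :
    ∃ b ∈ R, p.1 < rightEdge b ∧ p.2 < topEdge b := by
  have hcont : Filter.Tendsto (fun t : ℝ => (p.1 + t, p.2 + t)) (nhdsWithin 0 (Ioi 0)) (nhds p) := by
    have : Continuous fun t : ℝ => (p.1 + t, p.2 + t) := by fun_prop
    simpa using (this.tendsto 0).mono_left nhdsWithin_le_nhds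
  obtain ⟨t, ⟨b, hb, hmem⟩, ht⟩ :=
    ((hcont.eventually (mem_interior_iff_mem_nhds.1 hp)).and self_mem_nhdsWithin).exists
  have hmem := (hR b hb).mem_iff.1 hmem
  have ht : 0 < t := ht
  exact ⟨b, hb, by linarith [hmem.1.2], by linarith [hmem.2.2]⟩

namespace IsTiling

variable {M R : Finset (Set (ℝ × ℝ))} {W H : ℝ}

theorem mem_interior_of_lower (hM : IsTiling M W H) (hR : IsLowerFamily M R)
    {b : Set (ℝ × ℝ)} (hb : b ∈ R) {p : ℝ × ℝ} (h1 : 0 < p.1) (h2 : p.1 < rightEdge b)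
    (h3 : 0 < p.2) (h4 : p.2 < topEdge b) : p ∈ interior (⋃₀ (R : Set (Set (ℝ × ℝ)))) := by
  refine mem_interior.2 ⟨Ioo 0 (rightEdge b) ×ˢ Ioo 0 (topEdge b), ?_,
    isOpen_Ioo.prod isOpen_Ioo, ⟨⟨h1, h2⟩, h3, h4⟩⟩
  rintro ⟨x, y⟩ ⟨hx, hy⟩
  have hbd := hM.bounds b (hR.1 hb)
  obtain ⟨c, hc, hcx, hcy⟩ := hM.cover x y hx.1.le (hx.2.le.trans hbd.1.2) hy.1.le
    (hy.2.le.trans hbd.2.2)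
  exact ⟨c, hR.2 b hb c hc ⟨hcx.1.trans_lt hx.2, hcy.1.trans_lt hy.2⟩,
    (hM.block c hc).mem_iff.2 ⟨hcx, hcy⟩⟩

theorem isDeletable_iff (hM : IsTiling M W H) (hR : IsLowerFamily M R) {r : Set (ℝ × ℝ)} :
    IsDeletable R r ↔ IsMaximalBlock R r := by
  have hcl : IsClosed (⋃₀ (R : Set (Set (ℝ × ℝ)))) := by
    rw [sUnion_eq_biUnion]
    exact R.finite_toSet.isClosed_biUnion fun b hb => (hM.block b (hR.1 hb)).isClosed
  constructor
  · rintro ⟨hr, x1, x2, y1, y2, hx, hy, rfl, htop, hright⟩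
    obtain ⟨e1, e2, e3, e4⟩ := edges_Icc_prod hx hy
    have hbd := hM.bounds _ (hR.1 hr)
    rw [e1, e2, e3, e4] at hbd
    refine ⟨hr, fun b hb hrb => ?_⟩
    rw [Precedes, e1, e3] at hrb
    by_contra hne
    have hbb := hM.block b (hR.1 hb)
    obtain ⟨hbx, hby, -⟩ := hbb.edges
    have htop' : topEdge b ≤ y2 := by
      by_contra! hlt
      obtain ⟨t, ht1, ht2⟩ := exists_between (lt_min hx hrb.1)
      obtain ⟨ht2, ht3⟩ := lt_min_iff.1 ht2
      refine (htop (show (t, y2) ∈ _ from ⟨⟨ht1.le, ht2.le⟩, rfl⟩)).2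
        (hM.mem_interior_of_lower hR hb ?_ ht3 ?_ hlt) <;> dsimp only <;> linarith
    have hright' : rightEdge b ≤ x2 := by
      by_contra! hlt
      obtain ⟨t, ht1, ht2⟩ := exists_between (lt_min hy hrb.2)
      obtain ⟨ht2, ht3⟩ := lt_min_iff.1 ht2
      refine (hright (show (x2, t) ∈ _ from ⟨rfl, ⟨ht1.le, ht2.le⟩⟩)).2
        (hM.mem_interior_of_lower hR hb ?_ hlt ?_ ht3) <;> dsimp only <;> linarith
    refine hne (hM.disjoint b (hR.1 hb) _ (hR.1 hr) ?_ ?_ ?_ ?_)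
    · rw [e2]; linarith
    · rw [e1]; exact hrb.1
    · rw [e4]; linarith
    · rw [e3]; exact hrb.2
  · rintro ⟨hr, hmax⟩
    have hbr := hM.block r (hR.1 hr)
    obtain ⟨hx, hy, heq⟩ := hbr.edges
    have hblock : ∀ b ∈ R, IsBlock b := fun b hb => hM.block b (hR.1 hb)
    have hsub : r ⊆ ⋃₀ (R : Set (Set (ℝ × ℝ))) := subset_sUnion_of_mem hr
    refine ⟨hr, _, _, _, _, hx, hy, heq, ?_, ?_⟩
    · rintro ⟨x, y⟩ ⟨hxm, rfl⟩
      rw [hcl.frontier_eq]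
      refine ⟨hsub (hbr.mem_iff.2 ⟨hxm, hy.le, le_rfl⟩), fun hint => ?_⟩
      obtain ⟨b, hb, h1, h2⟩ := exists_block_of_mem_interior hblock hint
      rw [hmax b hb ⟨hxm.1.trans_lt h1, hy.trans h2⟩] at h2
      exact h2.false
    · rintro ⟨x, y⟩ ⟨rfl, hym⟩
      rw [hcl.frontier_eq]
      refine ⟨hsub (hbr.mem_iff.2 ⟨⟨hx.le, le_rfl⟩, hym⟩), fun hint => ?_⟩
      obtain ⟨b, hb, h1, h2⟩ := exists_block_of_mem_interior hblock hint
      rw [hmax b hb ⟨hx.trans h1, hym.1.trans_lt h2⟩] at h1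
      exact h1.false

/-- Every nonempty subfamily of a tiling has a maximal block. -/
theorem exists_isMaximalBlock (hM : IsTiling M W H) (hR : R ⊆ M) (hne : R.Nonempty) :
    ∃ r, IsMaximalBlock R r := by
  classical
  let T := R.filter fun r => ∀ b ∈ R, leftEdge r < rightEdge b → topEdge b ≤ topEdge r
  have hT : T.Nonempty := by
    obtain ⟨r, hr, hmax⟩ := R.exists_max_image topEdge hne
    exact ⟨r, Finset.mem_filter.2 ⟨hr, fun b hb _ => hmax b hb⟩⟩
  obtain ⟨r, hrT, hrmax⟩ := T.exists_max_image rightEdge hT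
  obtain ⟨hr, hrtop⟩ := Finset.mem_filter.1 hrT
  obtain ⟨hrx, hry, -⟩ := (hM.block r (hR hr)).edges
  let S := R.filter fun b => rightEdge r < rightEdge b ∧ botEdge r < topEdge b
  have hS : ¬ S.Nonempty := by
    intro hS
    obtain ⟨b, hbS, hbmax⟩ := S.exists_max_image topEdge hS
    obtain ⟨hb, hb1, hb2⟩ := Finset.mem_filter.1 hbS
    obtain ⟨hbx, hby, -⟩ := (hM.block b (hR hb)).edges
    have hbr := hrtop b hb (hrx.trans hb1)
    refine not_le.2 hb1 (hrmax b (Finset.mem_filter.2 ⟨hb, fun c hc hbc => ?_⟩))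
    by_contra! hlt
    have hcr : rightEdge c ≤ rightEdge r := by
      by_contra! h
      exact not_le.2 hlt (hbmax c (Finset.mem_filter.2 ⟨hc, h, hb2.trans hlt⟩))
    have heq := hM.disjoint b (hR hb) r (hR hr) (by linarith) (by linarith) (by linarith) hb2
    rw [heq] at hb1
    exact hb1.false
  refine ⟨r, hr, fun b hb hrb => ?_⟩
  have h1 := hrtop b hb hrb.1
  have h2 : rightEdge b ≤ rightEdge r := by
    by_contra! h
    exact hS ⟨b, Finset.mem_filter.2 ⟨hb, h, hrb.2⟩⟩
  obtain ⟨hbx, hby, -⟩ := (hM.block b (hR hb)).edges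
  exact hM.disjoint b (hR hb) r (hR hr) (by linarith) hrb.1 (by linarith) hrb.2

/-- A maximal block of a tiling of `[0,W] × [0,H]` contains the corner `(W,H)`. -/
theorem eq_corner_of_isMaximalBlock (hM : IsTiling M W H) {r : Set (ℝ × ℝ)}
    (hr : IsMaximalBlock M r) : rightEdge r = W ∧ topEdge r = H := by
  have hbd := hM.bounds r hr.1
  obtain ⟨hx, hy, -⟩ := (hM.block r hr.1).edges
  constructor
  · by_contra hne
    obtain ⟨b, hb, h1, h2⟩ := hM.exists_upper_right (x := rightEdge r) (y := botEdge r)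
      (by linarith) (lt_of_le_of_ne hbd.1.2 hne) hbd.2.1 (by linarith)
    rw [hr.2 b hb ⟨hx.trans h1.2, h2.2⟩] at h1
    exact h1.2.false
  · by_contra hne
    obtain ⟨b, hb, h1, h2⟩ := hM.exists_upper_right (x := leftEdge r) (y := topEdge r)
      hbd.1.1 (by linarith) (by linarith) (lt_of_le_of_ne hbd.2.2 hne)
    rw [hr.2 b hb ⟨h1.2, hy.trans h2.2⟩] at h2
    exact h2.2.false

theorem isMaximalBlock_unique (hM : IsTiling M W H) {d e : Set (ℝ × ℝ)}
    (hd : IsMaximalBlock M d) (he : IsMaximalBlock M e) : d = e := by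
  have hd' := hM.eq_corner_of_isMaximalBlock hd
  have he' := hM.eq_corner_of_isMaximalBlock he
  obtain ⟨hx, hy, -⟩ := (hM.block e he.1).edges
  exact he.2 d hd.1 ⟨by rwa [hd'.1, ← he'.1], by rwa [hd'.2, ← he'.2]⟩

/-- A block that becomes maximal when the maximal block `r` is erased precedes `r`. -/
theorem precedes_of_isMaximalBlock_erase {r a : Set (ℝ × ℝ)}
    (huniq : ∀ b, IsMaximalBlock R b → b = r) (ha : IsMaximalBlock (R.erase r) a) :
    Precedes a r := by
  obtain ⟨har, haR⟩ := Finset.mem_erase.1 ha.1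
  by_contra hnot
  refine har (huniq a ⟨haR, fun b hb hab => ha.2 b (Finset.mem_erase.2 ⟨?_, hb⟩) hab⟩)
  rintro rfl
  exact hnot hab

theorem corner_of_topEdge_lt (hM : IsTiling M W H) (hR : IsLowerFamily M R)
    {r a : Set (ℝ × ℝ)} (hr : r ∈ R) (ha : IsMaximalBlock (R.erase r) a) (har : Precedes a r)
    (hlt : topEdge a < topEdge r) : leftEdge r ≤ leftEdge a ∧ botEdge r ≤ topEdge a := by
  have haM := hR.1 (Finset.mem_of_mem_erase ha.1)
  have hbr := hM.bounds r (hR.1 hr)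
  have hba := hM.bounds a haM
  obtain ⟨-, hay, -⟩ := (hM.block a haM).edges
  obtain ⟨b, hb, h1, h2⟩ := hM.exists_upper_right (x := leftEdge a) (y := topEdge a) hba.1.1
    (har.1.trans_le hbr.1.2) (by linarith) (hlt.trans_le hbr.2.2)
  have hbR : b ∈ R := hR.2 r hr b hb ⟨h1.1.trans_lt har.1, h2.1.trans_lt hlt⟩
  by_cases hbr : b = r
  · subst hbr
    exact ⟨h1.1, h2.1⟩
  · rw [ha.2 b (Finset.mem_erase.2 ⟨hbr, hbR⟩) ⟨h1.2, hay.trans h2.2⟩] at h2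
    exact absurd h2.2 (lt_irrefl _)

theorem corner_of_rightEdge_lt (hM : IsTiling M W H) (hR : IsLowerFamily M R)
    {r a : Set (ℝ × ℝ)} (hr : r ∈ R) (ha : IsMaximalBlock (R.erase r) a) (har : Precedes a r)
    (hlt : rightEdge a < rightEdge r) : leftEdge r ≤ rightEdge a ∧ botEdge r ≤ botEdge a := by
  have haM := hR.1 (Finset.mem_of_mem_erase ha.1)
  have hbr := hM.bounds r (hR.1 hr)
  have hba := hM.bounds a haM
  obtain ⟨hax, -, -⟩ := (hM.block a haM).edges
  obtain ⟨b, hb, h1, h2⟩ := hM.exists_upper_right (x := rightEdge a) (y := botEdge a)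
    (by linarith) (hlt.trans_le hbr.1.2) hba.2.1 (har.2.trans_le hbr.2.2)
  have hbR : b ∈ R := hR.2 r hr b hb ⟨h1.1.trans_lt hlt, h2.1.trans_lt har.2⟩
  by_cases hbr : b = r
  · subst hbr
    exact ⟨h1.1, h2.1⟩
  · rw [ha.2 b (Finset.mem_erase.2 ⟨hbr, hbR⟩) ⟨hax.trans h1.2, h2.2⟩] at h1
    exact absurd h1.2 (lt_irrefl _)

/-- In standard form, a block `r` cannot have at the same time a neighbour `d` on its left whose
bottom edge is not below that of `r`, and a neighbour `e` below it whose left edge is not to the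
left of that of `r`. -/
theorem false_of_neighbours (hM : IsTiling M W H) (hstd : StandardForm M)
    {r d e : Set (ℝ × ℝ)} (hr : r ∈ M) (hd : d ∈ M) (he : e ∈ M)
    (hdr : rightEdge d = leftEdge r) (hd1 : botEdge r ≤ botEdge d) (hd2 : botEdge d < topEdge r)
    (her : topEdge e = botEdge r) (he1 : leftEdge r ≤ leftEdge e)
    (he2 : leftEdge e < rightEdge r) : False := by
  have hbr := hM.bounds r hr
  have hbd := hM.bounds d hd
  have hbe := hM.bounds e he
  obtain ⟨hrx, hry, -⟩ := (hM.block r hr).edges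
  obtain ⟨hdx, hdy, -⟩ := (hM.block d hd).edges
  obtain ⟨hex, hey, -⟩ := (hM.block e he).edges
  have hx0 : 0 < leftEdge r := by linarith
  have hy0 : 0 < botEdge r := by linarith
  have hxW : leftEdge r < W := by linarith
  have hyH : botEdge r < H := by linarith
  obtain ⟨f, hf, hf1, hf2⟩ := hM.exists_upper_left hx0 hxW.le hy0.le hyH
  obtain ⟨k, hk, hk1, hk2⟩ := hM.exists_lower_right hx0.le hxW hy0 hyH.le
  obtain ⟨g, hg, hg1, hg2⟩ := hM.exists_lower_left hx0 hxW.le hy0 hyH.le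
  have hfr : rightEdge f = leftEdge r := by
    refine le_antisymm (not_lt.1 fun hlt => ?_) hf1.2
    have := hM.disjoint f hf r hr (by linarith) hlt (by linarith) hf2.2
    rw [this] at hf1
    exact hf1.1.false
  have hkr : topEdge k = botEdge r := by
    refine le_antisymm (not_lt.1 fun hlt => ?_) hk2.2
    have := hM.disjoint k hk r hr (by linarith) hk1.2 (by linarith) hlt
    rw [this] at hk2
    exact hk2.1.false
  have hmem : ∀ b ∈ M, leftEdge b ≤ leftEdge r → leftEdge r ≤ rightEdge b →
      botEdge b ≤ botEdge r → botEdge r ≤ topEdge b → (leftEdge r, botEdge r) ∈ b :=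
    fun b hb h1 h2 h3 h4 => (hM.block b hb).mem_iff.2 ⟨⟨h1, h2⟩, h3, h4⟩
  rcases hM.not_four (leftEdge r, botEdge r) r f k g hr hf hk hg
    (hmem r hr le_rfl hrx.le le_rfl hry.le) (hmem f hf hf1.1.le hf1.2 hf2.1 hf2.2.le)
    (hmem k hk hk1.1 hk1.2.le hk2.1.le hk2.2) (hmem g hg hg1.1.le hg1.2 hg2.1.le hg2.2)
    with h | h | h | h | h | h
  · rw [← h] at hf1
    exact hf1.1.false
  · rw [← h] at hk2
    exact hk2.1.false
  · rw [← h] at hg1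
    exact hg1.1.false
  · rw [← h, hfr] at hk1
    exact hk1.2.false
  · rw [← h] at hg2
    refine hM.false_of_left_neighbours hstd hr hf hd hfr hdr hg2.1 hf2.2
      (lt_of_le_of_ne hd1 fun heq => ?_) hd2
    have hfd := hM.disjoint f hf d hd (by linarith) (by linarith) (by linarith) (by linarith)
    rw [hfd, ← heq] at hg2
    exact hg2.1.false
  · rw [← h] at hg1
    refine hM.false_of_lower_neighbours hstd hr hk he hkr her hg1.1 hk1.2
      (lt_of_le_of_ne he1 fun heq => ?_) he2
    have hke := hM.disjoint k hk e he (by linarith) (by linarith) (by linarith) (by linarith)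
    rw [hke, ← heq] at hg1
    exact hg1.1.false

theorem false_of_isMaximalBlock_erase (hM : IsTiling M W H) (hstd : StandardForm M)
    (hR : IsLowerFamily M R) {r d e : Set (ℝ × ℝ)} (hr : IsMaximalBlock R r)
    (huniq : ∀ b, IsMaximalBlock R b → b = r) (hd : IsMaximalBlock (R.erase r) d)
    (he : IsMaximalBlock (R.erase r) e) (h1 : rightEdge d ≤ leftEdge e)
    (h2 : topEdge e ≤ botEdge d) : False := by
  have hdr := precedes_of_isMaximalBlock_erase huniq hd
  have her := precedes_of_isMaximalBlock_erase huniq he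
  obtain ⟨hdne, hdR⟩ := Finset.mem_erase.1 hd.1
  obtain ⟨hene, heR⟩ := Finset.mem_erase.1 he.1
  obtain ⟨hrx, hry, -⟩ := (hM.block r (hR.1 hr.1)).edges
  obtain ⟨hdx, hdy, -⟩ := (hM.block d (hR.1 hdR)).edges
  obtain ⟨hex, hey, -⟩ := (hM.block e (hR.1 heR)).edges
  obtain ⟨hd1, hd2⟩ := hdr
  obtain ⟨he1, he2⟩ := her
  have hd3 := hM.corner_of_rightEdge_lt hR hr.1 hd ⟨hd1, hd2⟩ (by linarith)
  have he3 := hM.corner_of_topEdge_lt hR hr.1 he ⟨he1, he2⟩ (by linarith)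
  refine hM.false_of_neighbours hstd (hR.1 hr.1) (hR.1 hdR) (hR.1 heR) ?_ hd3.2 hd2 ?_ he3.1 he1
  · refine le_antisymm (not_lt.1 fun hlt => ?_) hd3.1
    exact hdne (hM.disjoint d (hR.1 hdR) r (hR.1 hr.1) hd1 hlt hd2 (by linarith))
  · refine le_antisymm (not_lt.1 fun hlt => ?_) he3.2
    exact hene (hM.disjoint e (hR.1 heR) r (hR.1 hr.1) he1 (by linarith) he2 hlt)

theorem isMaximalBlock_erase_unique (hM : IsTiling M W H) (hstd : StandardForm M)
    (hR : IsLowerFamily M R) {r d e : Set (ℝ × ℝ)} (hr : IsMaximalBlock R r)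
    (huniq : ∀ b, IsMaximalBlock R b → b = r) (hd : IsMaximalBlock (R.erase r) d)
    (he : IsMaximalBlock (R.erase r) e) : d = e := by
  by_contra hne
  have hde : ¬ Precedes d e := fun h => hne (hd.2 e he.1 h).symm
  have hed : ¬ Precedes e d := fun h => hne (he.2 d hd.1 h)
  have hdM := hR.1 (Finset.mem_of_mem_erase hd.1)
  have heM := hR.1 (Finset.mem_of_mem_erase he.1)
  obtain ⟨hdx, hdy, -⟩ := (hM.block d hdM).edges
  obtain ⟨hex, hey, -⟩ := (hM.block e heM).edges
  simp only [Precedes, not_and_or, not_lt] at hde hed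
  rcases hde with h1 | h1 <;> rcases hed with h2 | h2
  · linarith
  · exact hM.false_of_isMaximalBlock_erase hstd hR hr huniq he hd h1 h2
  · exact hM.false_of_isMaximalBlock_erase hstd hR hr huniq hd he h2 h1
  · linarith

end IsTiling

/-- Let `M` be a mosaic floorplan in standard form with `n ≥ 1`
blocks, and let `R n = M, R (n-1), …, R 1` be obtained by successively removing a
deletable rectangle `r i` from `R i`. Then each staircase `R i` (`1 ≤ i ≤ n`) has
exactly one deletable rectangle. -/
theorem unique_deletable_in_peeling (n : ℕ) (hn : 1 ≤ n)
    (M : Finset (Set (ℝ × ℝ))) (hM : IsMosaicFloorplan M) (hstd : StandardForm M)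
    (hcard : M.card = n)
    (R : ℕ → Finset (Set (ℝ × ℝ))) (r : ℕ → Set (ℝ × ℝ))
    (hRn : R n = M)
    (hdel : ∀ i, 2 ≤ i → i ≤ n → IsDeletable (R i) (r i))
    (hprev : ∀ i, 2 ≤ i → i ≤ n → R (i - 1) = (R i).erase (r i)) :
    ∀ i, 1 ≤ i → i ≤ n → ∃! d, IsDeletable (R i) d := by
  obtain ⟨W, H, hT⟩ := hM.isTiling
  have key : ∀ k, k < n → (R (n - k)).card = n - k ∧ IsLowerFamily M (R (n - k)) ∧
      ∀ d e, IsMaximalBlock (R (n - k)) d → IsMaximalBlock (R (n - k)) e → d = e := by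
    intro k
    induction k with
    | zero =>
      intro _
      rw [Nat.sub_zero, hRn]
      exact ⟨hcard, ⟨subset_rfl, fun _ _ c hc _ => hc⟩, fun d e => hT.isMaximalBlock_unique⟩
    | succ k ih =>
      intro hk
      obtain ⟨hc, hlow, huniq⟩ := ih (by omega)
      have hmax := (hT.isDeletable_iff hlow).1 (hdel (n - k) (by omega) (by omega))
      rw [← Nat.sub_sub, hprev (n - k) (by omega) (by omega)]
      refine ⟨by rw [Finset.card_erase_of_mem hmax.1, hc], hlow.erase hmax, fun d e => ?_⟩
      exact hT.isMaximalBlock_erase_unique hstd hlow hmax fun b hb => huniq b _ hb hmax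
  intro i hi hin
  obtain ⟨hc, hlow, huniq⟩ := key (n - i) (by omega)
  rw [Nat.sub_sub_self hin] at hc hlow huniq
  simp only [hT.isDeletable_iff hlow]
  obtain ⟨d, hd⟩ := hT.exists_isMaximalBlock hlow.1 (Finset.card_pos.1 (by omega))
  exact ⟨d, hd, fun e he => huniq e d he hd⟩
end

section
/- Let R be a staircase with at least two blocks and m steps, and let r = [x1,x2]×[y1,y2] ∈ R be a deletable rectangle of type (0,1) whose top edge lies on the j-th step of R. Then R ∖ {r} is a staircase with exactly m steps. -/
open Set

theorem IsBlock.closure_interior {b : Set (ℝ × ℝ)} (hb : IsBlock b) :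
    closure (interior b) = b := by
  obtain ⟨x1, x2, y1, y2, hx, hy, rfl⟩ := hb
  rw [interior_prod_eq, closure_prod_eq, interior_Icc, interior_Icc, closure_Ioo hx.ne,
    closure_Ioo hy.ne]

/-- Removing a block from a finite family of interior-disjoint blocks leaves the closure of the
set difference. -/
theorem sUnion_erase_eq_closure {R : Finset (Set (ℝ × ℝ))} (hb : ∀ b ∈ R, IsBlock b)
    (hd : ∀ b ∈ R, ∀ b' ∈ R, b ≠ b' → interior b ∩ interior b' = ∅)
    {r : Set (ℝ × ℝ)} (hr : r ∈ R) :
    ⋃₀ ((R.erase r : Finset (Set (ℝ × ℝ))) : Set (Set (ℝ × ℝ))) =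
      closure (⋃₀ (R : Set (Set (ℝ × ℝ))) \ r) := by
  apply Subset.antisymm
  · rintro p ⟨b, hbR, hp⟩
    obtain ⟨hne, hbR⟩ := Finset.mem_erase.1 (Finset.mem_coe.1 hbR)
    rw [← (hb b hbR).closure_interior] at hp
    refine closure_mono ?_ hp
    intro q hq
    refine ⟨⟨b, hbR, interior_subset hq⟩, fun hqr => ?_⟩
    have hdisj : Disjoint (interior b) (interior r) :=
      disjoint_iff_inter_eq_empty.2 (hd b hbR r hr hne)
    have := hdisj.closure_right isOpen_interior
    rw [(hb r hr).closure_interior] at this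
    exact disjoint_left.1 this hq hqr
  · refine closure_minimal ?_ ?_
    · rintro p ⟨⟨b, hbR, hp⟩, hpr⟩
      exact ⟨b, Finset.mem_coe.2 (Finset.mem_erase.2 ⟨fun h => hpr (h ▸ hp), hbR⟩), hp⟩
    · rw [sUnion_eq_biUnion]
      refine (Finset.finite_toSet _).isClosed_biUnion fun b hbR => ?_
      rw [← (hb b (Finset.mem_of_mem_erase hbR)).closure_interior]
      exact isClosed_closure

theorem le_of_lt_succ_of_le {a : ℕ → ℝ} {m : ℕ} (ha : ∀ j, j < m → a j < a (j + 1)) {i k : ℕ}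
    (hik : i ≤ k) (hkm : k ≤ m) : a i ≤ a k := by
  induction k, hik using Nat.le_induction with
  | base => exact le_rfl
  | succ k _ ih => exact (ih (by omega)).trans (ha k (by omega)).le

/-- The closure of the region under a staircase boundary, minus a rectangle of type `(0,1)` on its
`j`-th step, is the region in which the `j`-th step ends at the left side of that rectangle. -/
theorem closure_steps_diff_eq {m : ℕ} {a h : ℕ → ℝ} (ha : ∀ j, j < m → a j < a (j + 1))
    (hh : ∀ j, 1 ≤ j → j < m → h (j + 1) < h j) (hm : 0 < h m) {j : ℕ} (hj1 : 1 ≤ j)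
    (hjm : j ≤ m) {x1 y1 : ℝ} (hx : x1 < a j) (hx1 : a (j - 1) < x1)
    (hy1 : y1 = (if j < m then h (j + 1) else 0)) :
    closure ((⋃ k ∈ Finset.Icc 1 m, Icc (a (k - 1)) (a k) ×ˢ Icc (0 : ℝ) (h k)) \
        (Icc x1 (a j) ×ˢ Icc y1 (h j))) =
      ⋃ k ∈ Finset.Icc 1 m, Icc (Function.update a j x1 (k - 1)) (Function.update a j x1 k) ×ˢ
        Icc (0 : ℝ) (h k) := by
  have hpos : ∀ k, 1 ≤ k → k ≤ m → 0 < h k := by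
    intro k hk hkm
    induction hkm using Nat.decreasingInduction with
    | of_succ k hkm ih => exact (ih (by omega)).trans (hh k hk hkm)
    | self => exact hm
  apply Subset.antisymm
  · refine closure_minimal ?_
      (isClosed_biUnion_finset fun k _ => isClosed_Icc.prod isClosed_Icc)
    rintro ⟨x, y⟩ ⟨hp, hr⟩
    simp only [mem_iUnion, mem_prod, mem_Icc, Finset.mem_Icc, exists_prop] at hp hr ⊢
    obtain ⟨k, ⟨hk1, hkm⟩, ⟨hxl, hxr⟩, hyl, hyr⟩ := hp
    rcases eq_or_ne k j with rfl | hkj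
    · rcases le_or_gt x x1 with hxx | hxx
      · refine ⟨k, ⟨hk1, hkm⟩, ⟨?_, ?_⟩, hyl, hyr⟩
        · rwa [Function.update_of_ne (by omega)]
        · rwa [Function.update_self]
      · have hy : y < y1 := by
          by_contra! hy
          exact hr ⟨⟨hxx.le, hxr⟩, hy, hyr⟩
        have hlt : k < m := by
          by_contra hlt
          rw [if_neg hlt] at hy1
          linarith
        rw [if_pos hlt] at hy1
        refine ⟨k + 1, ⟨by omega, hlt⟩, ⟨?_, ?_⟩, hyl, by linarith⟩
        · rw [Nat.add_sub_cancel, Function.update_self]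
          exact hxx.le
        · rw [Function.update_of_ne (by omega)]
          exact hxr.trans (ha k hlt).le
    · refine ⟨k, ⟨hk1, hkm⟩, ⟨?_, ?_⟩, hyl, hyr⟩
      · rcases eq_or_ne (k - 1) j with rfl | hkj'
        · rw [Function.update_self]
          linarith
        · rwa [Function.update_of_ne hkj']
      · rwa [Function.update_of_ne hkj]
  · refine iUnion₂_subset fun k hk => ?_
    obtain ⟨hk1, hkm⟩ := Finset.mem_Icc.1 hk
    have hstep : a (k - 1) < a k := by
      simpa [Nat.sub_add_cancel hk1] using ha (k - 1) (by omega)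
    have hne : Function.update a j x1 (k - 1) ≠ Function.update a j x1 k := by
      simp only [Function.update_apply]
      split_ifs with h1 h2 h2
      · omega
      · rw [h1] at hstep
        linarith
      · rw [h2] at *
        linarith
      · exact hstep.ne
    rw [← closure_Ioo hne, ← closure_Ioo (hpos k hk1 hkm).ne, ← closure_prod_eq]
    refine closure_mono ?_
    rintro ⟨x, y⟩ ⟨⟨hxl, hxr⟩, hyl, hyr⟩
    simp only [mem_sdiff, mem_iUnion, mem_prod, mem_Icc, Finset.mem_Icc, exists_prop]
      at hxl hxr hyl hyr ⊢
    rcases lt_trichotomy k j with hkj | rfl | hkj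
    · rw [Function.update_of_ne (by omega)] at hxl hxr
      have := le_of_lt_succ_of_le ha (show k ≤ j - 1 by omega) (by omega)
      exact ⟨⟨k, ⟨hk1, hkm⟩, ⟨hxl.le, hxr.le⟩, hyl.le, hyr.le⟩, fun hr => by linarith [hr.1.1]⟩
    · rw [Function.update_of_ne (by omega)] at hxl
      rw [Function.update_self] at hxr
      exact ⟨⟨k, ⟨hk1, hkm⟩, ⟨hxl.le, (hxr.trans hx).le⟩, hyl.le, hyr.le⟩,
        fun hr => by linarith [hr.1.1]⟩
    · rw [Function.update_of_ne (by omega)] at hxr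
      rcases eq_or_ne (k - 1) j with hkj' | hkj'
      · obtain rfl : k = j + 1 := by omega
        rw [Nat.add_sub_cancel, Function.update_self] at hxl
        rw [if_pos (by omega)] at hy1
        refine ⟨?_, fun hr => by linarith [hr.2.1]⟩
        rcases le_or_gt x (a j) with hxx | hxx
        · exact ⟨j, ⟨hj1, hjm⟩, ⟨by linarith, hxx⟩, hyl.le,
            by linarith [hh j hj1 (by omega)]⟩
        · exact ⟨j + 1, ⟨hk1, hkm⟩, ⟨hxx.le, hxr.le⟩, hyl.le, hyr.le⟩
      · rw [Function.update_of_ne hkj'] at hxl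
        have := le_of_lt_succ_of_le ha (show j ≤ k - 1 by omega) (by omega)
        exact ⟨⟨k, ⟨hk1, hkm⟩, ⟨hxl.le, hxr.le⟩, hyl.le, hyr.le⟩, fun hr => by linarith [hr.1.2]⟩

/-- Let `R` be a staircase with at least two blocks and `m`
steps, and let `r = [x1,x2] × [y1,y2] ∈ R` be a deletable rectangle of type
`(0,1)` whose top edge lies on the `j`-th step of `R` (so `y2 = h j` and
`x2 = a j`; here `h'` is `h (j+1)` if `j < m` and `0` if `j = m`).
Then `R \ {r}` is a staircase with exactly `m` steps. -/
theorem erase_type01_steps (R : Finset (Set (ℝ × ℝ))) (m : ℕ) (a h : ℕ → ℝ)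
    (hR : IsStaircaseWith R m a h) (hcard : 2 ≤ R.card)
    (x1 x2 y1 y2 : ℝ) (hx : x1 < x2) (hy : y1 < y2)
    (hr : IsDeletable R (Icc x1 x2 ×ˢ Icc y1 y2))
    (j : ℕ) (hj1 : 1 ≤ j) (hjm : j ≤ m)
    (htop : y2 = h j) (hright : x2 = a j)
    (htype1 : a (j - 1) < x1)
    (htype2 : y1 = (if j < m then h (j + 1) else 0)) :
    ∃ a' h', IsStaircaseWith (R.erase (Icc x1 x2 ×ˢ Icc y1 y2)) (m) a' h' := by
  obtain ⟨-, hb, hd, h4, hm1, ha0, ha, hh, hm, hU⟩ := hR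
  subst htop hright
  have hsub : ∀ b ∈ R.erase (Icc x1 (a j) ×ˢ Icc y1 (h j)), b ∈ R := fun b =>
    Finset.mem_of_mem_erase
  refine ⟨Function.update a j x1, h, ?_, fun b hbR => hb b (hsub b hbR),
    fun b hbR b' hbR' => hd b (hsub b hbR) b' (hsub b' hbR'),
    fun p b1 b2 b3 b4 h1 h2 h3 h4' => h4 p b1 b2 b3 b4 (hsub _ h1) (hsub _ h2) (hsub _ h3)
      (hsub _ h4'), hm1, ?_, ?_, hh, hm, ?_⟩
  · rw [← Finset.card_pos, Finset.card_erase_of_mem hr.1]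
    omega
  · rwa [Function.update_of_ne (by omega)]
  · intro k hk
    have hstep := ha k hk
    simp only [Function.update_apply]
    split_ifs with h1 h2 h2
    · omega
    · subst h1
      linarith
    · rwa [show k = j - 1 by omega]
    · exact hstep
  · rw [sUnion_erase_eq_closure hb hd hr.1, hU,
      closure_steps_diff_eq ha hh hm hj1 hjm hx htype1 htype2]
end
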